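/- arXiv:2602.06348 — 6 statements merged into one kernel-verified Lean document; each statement's English description precedes it below -/
import Mathlib

section
/- Let a and b be real numbers with |a| ≤ 1/2 and |b| ≤ 1/2. Then the Kullback–Leibler divergence between the two-point distributions with means a and b satisfies ((1+a)/2) * log((1+a)/(1+b)) + ((1-a)/2) * log((1-a)/(1-b)) ≤ (a-b)^2. -/
/-- The divergence bound when the first mean is smaller than the second, by the mean value theorem
applied to the difference of the two sides as a function of the second mean. -/
theorem klDiv_rad_le_of_lt {a b : ℝ} (ha : -(1 / 2) ≤ a) (hb : b ≤ 1 / 2) (hab : a < b) :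
    (1 + a) / 2 * Real.log ((1 + a) / (1 + b)) + (1 - a) / 2 * Real.log ((1 - a) / (1 - b))
      ≤ (a - b) ^ 2 := by
  set h : ℝ → ℝ := fun x =>
    (x - a) ^ 2 + (1 + a) / 2 * Real.log (1 + x) + (1 - a) / 2 * Real.log (1 - x) with h_def
  have hderiv : ∀ x ∈ Set.Icc a b,
      HasDerivAt h (2 * (x - a) + (1 + a) / 2 * (1 / (1 + x)) + (1 - a) / 2 * (-1 / (1 - x))) x := by
    intro x hx
    have h₁ : HasDerivAt (fun x : ℝ => (x - a) ^ 2) (2 * (x - a)) x := by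
      simpa using ((hasDerivAt_id x).sub_const a).fun_pow 2
    have h₂ := ((hasDerivAt_id x).const_add 1).log
      (show (1 : ℝ) + x ≠ 0 by linarith [hx.1])
    have h₃ := ((hasDerivAt_id x).const_sub 1).log
      (show (1 : ℝ) - x ≠ 0 by linarith [hx.2])
    exact (h₁.add (h₂.const_mul _)).add (h₃.const_mul _)
  obtain ⟨c, hc, hslope⟩ := exists_hasDerivAt_eq_slope h _ hab
    (fun x hx => (hderiv x hx).continuousAt.continuousWithinAt)
    (fun x hx => hderiv x (Set.Ioo_subset_Icc_self hx))
  have hc₁ : 0 < 1 + c := by linarith [hc.1]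
  have hc₂ : 0 < 1 - c := by linarith [hc.2]
  have hfactor : 2 * (c - a) + (1 + a) / 2 * (1 / (1 + c)) + (1 - a) / 2 * (-1 / (1 - c))
      = (c - a) * (1 - 2 * c ^ 2) / ((1 + c) * (1 - c)) := by
    field_simp
    ring
  have hnonneg : 0 ≤ (c - a) * (1 - 2 * c ^ 2) / ((1 + c) * (1 - c)) :=
    div_nonneg (mul_nonneg (by linarith [hc.1]) (by nlinarith [hc.1, hc.2]))
      (mul_pos hc₁ hc₂).le
  rw [← hfactor, hslope, le_div_iff₀ (sub_pos.2 hab), zero_mul] at hnonneg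
  rw [Real.log_div (by linarith) (by linarith), Real.log_div (by linarith) (by linarith)]
  simp only [h_def] at hnonneg
  linarith

theorem stmt_2 (a b : ℝ) (ha : |a| ≤ 1 / 2) (hb : |b| ≤ 1 / 2) :
    (1 + a) / 2 * Real.log ((1 + a) / (1 + b)) +
      (1 - a) / 2 * Real.log ((1 - a) / (1 - b)) ≤ (a - b) ^ 2 := by
  rw [abs_le] at ha hb
  rcases lt_trichotomy a b with hab | rfl | hab
  · exact klDiv_rad_le_of_lt ha.1 hb.2 hab
  · rw [div_self (show 1 + a ≠ 0 by linarith), div_self (show 1 - a ≠ 0 by linarith)]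
    simp
  · have key := klDiv_rad_le_of_lt (a := -a) (b := -b) (by linarith) (by linarith) (by linarith)
    simp only [sub_neg_eq_add, ← sub_eq_add_neg] at key
    linarith
end

section
/- Let a, b, c, d be real numbers in [-1, 1] satisfying a > b, a > c, d > b, d > c, and b ≥ c (the paper's normalization, up to permuting rows and columns, of a 2×2 zero-sum game with a unique mixed-strategy Nash equilibrium). Let Δ_E = min{a-b, a-c, d-b, d-c}. Then the gap between the Nash value and the pure-strategy maximin value satisfies (a*d - b*c)/(a - b - c + d) - b ≥ Δ_E^2 / 4; equivalently, (a-b)*(d-b)/(a - b - c + d) ≥ Δ_E^2 / 4. -/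
theorem stmt_3 (a b c d : ℝ)
    (ha : a ∈ Set.Icc (-1 : ℝ) 1) (hb : b ∈ Set.Icc (-1 : ℝ) 1)
    (hc : c ∈ Set.Icc (-1 : ℝ) 1) (hd : d ∈ Set.Icc (-1 : ℝ) 1)
    (hab : b < a) (hac : c < a) (hdb : b < d) (hdc : c < d) (hbc : c ≤ b) :
    min (min (a - b) (a - c)) (min (d - b) (d - c)) ^ 2 / 4 ≤
      (a * d - b * c) / (a - b - c + d) - b ∧
    min (min (a - b) (a - c)) (min (d - b) (d - c)) ^ 2 / 4 ≤
      (a - b) * (d - b) / (a - b - c + d) := by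
  have hpos : 0 < a - b - c + d := by linarith
  have gap_eq : (a * d - b * c) / (a - b - c + d) - b =
      (a - b) * (d - b) / (a - b - c + d) := by
    rw [div_sub' hpos.ne']
    ring
  rw [gap_eq, and_self]
  set m := min (min (a - b) (a - c)) (min (d - b) (d - c))
  have hm : 0 ≤ m := by
    refine le_min (le_min ?_ ?_) (le_min ?_ ?_) <;> linarith
  have hma : m ≤ a - b := (min_le_left _ _).trans (min_le_left _ _)
  have hmd : m ≤ d - b := (min_le_right _ _).trans (min_le_left _ _)
  have hsq : m ^ 2 ≤ (a - b) * (d - b) := by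
    rw [sq]
    exact mul_le_mul hma hmd hm (hm.trans hma)
  have hle : a - b - c + d ≤ 4 := by linarith [ha.2, hb.1, hc.1, hd.2]
  exact div_le_div₀ ((sq_nonneg m).trans hsq) hsq hpos hle
end

section
/- Let V be a real symmetric positive-definite d × d matrix and a ∈ ℝ^d, and set W = V + a aᵀ. Then aᵀ W⁻¹ a ≤ log det W - log det V. -/
open Matrix

/-- The matrix determinant lemma, for `vecMulVec`. -/
theorem Matrix.det_add_vecMulVec {n R : Type*} [Fintype n] [DecidableEq n] [CommRing R]
    {A : Matrix n n R} (hA : IsUnit A.det) (u v : n → R) :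
    (A + vecMulVec u v).det = A.det * (1 + v ⬝ᵥ (A⁻¹ *ᵥ u)) := by
  rw [vecMulVec_eq Unit, det_add_replicateCol_mul_replicateRow hA, det_unique (n := Unit),
    Matrix.mul_assoc, ← replicateCol_mulVec, Matrix.add_apply, one_apply_eq,
    replicateRow_mul_replicateCol_apply]

theorem stmt_8 (d : ℕ) (V : Matrix (Fin d) (Fin d) ℝ) (hV : V.PosDef) (a : Fin d → ℝ) :
    a ⬝ᵥ ((V + Matrix.vecMulVec a a)⁻¹ *ᵥ a) ≤
      Real.log (V + Matrix.vecMulVec a a).det - Real.log V.det := by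
  have hW : (V + vecMulVec a a).PosDef :=
    hV.add_posSemidef (by simpa using posSemidef_vecMulVec_self_star a)
  set W := V + vecMulVec a a with hWdef
  have hdet : V.det = W.det * (1 - a ⬝ᵥ (W⁻¹ *ᵥ a)) := by
    have h := det_add_vecMulVec hW.det_pos.ne'.isUnit (-a) a
    rwa [neg_vecMulVec, hWdef, add_neg_cancel_right, ← hWdef, mulVec_neg, dotProduct_neg,
      ← sub_eq_add_neg] at h
  have hpos : 0 < 1 - a ⬝ᵥ (W⁻¹ *ᵥ a) :=
    pos_of_mul_pos_right (hdet ▸ hV.det_pos) hW.det_pos.le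
  rw [hdet, Real.log_mul hW.det_pos.ne' hpos.ne']
  linarith [Real.log_le_sub_one_of_pos hpos]
end

section
/- Let d ≥ 1, λ > 0, T ≥ 0, and let a_1, ..., a_T ∈ ℝ^d satisfy ‖a_t‖₂ ≤ 1 for every t. Define V_0 = λ I_d and V_t = V_{t-1} + a_t a_tᵀ for t = 1, ..., T. Then Σ_{t=1}^T a_tᵀ (V_t)⁻¹ a_t ≤ d * log(1 + T/(λ d)). -/
open Matrix

/-- Rank-one update bound: `aᵀ A⁻¹ a ≤ log det A - log det B` when `A = B + a aᵀ`. -/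
lemma dotProduct_inv_mulVec_le_log_det_sub {n : Type*} [Fintype n] [DecidableEq n]
    {A B : Matrix n n ℝ} {a : n → ℝ} (hA : A.PosDef) (hB : B.PosDef)
    (h : A = B + vecMulVec a a) :
    a ⬝ᵥ (A⁻¹ *ᵥ a) ≤ Real.log A.det - Real.log B.det := by
  have hdet : B.det = A.det * (1 - a ⬝ᵥ (A⁻¹ *ᵥ a)) := by
    have hB' : B = A + replicateCol Unit (-a) * replicateRow Unit a := by
      rw [h, ← vecMulVec_eq, neg_vecMulVec]; abel
    rw [hB', det_add_replicateCol_mul_replicateRow hA.det_pos.ne'.isUnit]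
    congr 1
    rw [Matrix.mul_assoc, ← replicateCol_mulVec]
    simp [det_unique, Matrix.mul_apply, dotProduct, mulVec_neg, sub_eq_add_neg]
  have hpos : 0 < 1 - a ⬝ᵥ (A⁻¹ *ᵥ a) :=
    pos_of_mul_pos_right (hdet ▸ hB.det_pos) hA.det_pos.le
  rw [hdet, Real.log_mul hA.det_pos.ne' hpos.ne']
  linarith [Real.log_le_sub_one_of_pos hpos]

/-- The logarithmic AM-GM inequality between determinant and trace. -/
lemma Matrix.PosDef.log_det_le_card_mul_log {n : Type*} [Fintype n] [DecidableEq n]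
    {A : Matrix n n ℝ} (hA : A.PosDef) {c : ℝ} (hc : 0 < c)
    (htr : A.trace ≤ Fintype.card n * c) :
    Real.log A.det ≤ Fintype.card n * Real.log c := by
  have hlog : Real.log A.det = ∑ i, Real.log (hA.isHermitian.eigenvalues i) := by
    rw [hA.isHermitian.det_eq_prod_eigenvalues]
    simp only [RCLike.ofReal_real_eq_id, id]
    exact Real.log_prod fun i _ => (hA.eigenvalues_pos i).ne'
  have hsum : A.trace = ∑ i, hA.isHermitian.eigenvalues i := by
    simpa using hA.isHermitian.trace_eq_sum_eigenvalues
  have hle : ∀ i, Real.log (hA.isHermitian.eigenvalues i) ≤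
      Real.log c + (hA.isHermitian.eigenvalues i / c - 1) := fun i => by
    have hi := hA.eigenvalues_pos i
    have := Real.log_le_sub_one_of_pos (div_pos hi hc)
    rw [Real.log_div hi.ne' hc.ne'] at this
    linarith
  calc Real.log A.det
      ≤ ∑ i, (Real.log c + (hA.isHermitian.eigenvalues i / c - 1)) :=
        hlog ▸ Finset.sum_le_sum fun i _ => hle i
    _ = Fintype.card n * Real.log c + (A.trace / c - Fintype.card n) := by
        simp [Finset.sum_add_distrib, Finset.sum_sub_distrib, ← Finset.sum_div, hsum]
    _ ≤ Fintype.card n * Real.log c := by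
        linarith [(div_le_iff₀ hc).2 htr]

theorem stmt_11 (d : ℕ) (hd : 1 ≤ d) (lam : ℝ) (hlam : 0 < lam) (T : ℕ)
    (a : ℕ → (Fin d → ℝ)) (ha : ∀ t, Real.sqrt (∑ i, a t i ^ 2) ≤ 1)
    (V : ℕ → Matrix (Fin d) (Fin d) ℝ)
    (hV0 : V 0 = lam • (1 : Matrix (Fin d) (Fin d) ℝ))
    (hVs : ∀ t, V (t + 1) = V t + Matrix.vecMulVec (a (t + 1)) (a (t + 1))) :
    ∑ t ∈ Finset.Icc 1 T, a t ⬝ᵥ ((V t)⁻¹ *ᵥ a t) ≤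
      d * Real.log (1 + T / (lam * d)) := by
  have hd0 : (0 : ℝ) < d := by exact_mod_cast hd
  have hpos : ∀ t, (V t).PosDef := fun t => by
    induction t with
    | zero => exact hV0 ▸ PosDef.one.smul hlam
    | succ t ih =>
      rw [hVs]
      exact ih.add_posSemidef (by simpa using posSemidef_vecMulVec_self_star (a (t + 1)))
  have htrace : ∀ t : ℕ, (V t).trace ≤ d * lam + t := fun t => by
    induction t with
    | zero => simp [hV0, mul_comm]
    | succ t ih =>
      have h1 : a (t + 1) ⬝ᵥ a (t + 1) ≤ 1 := by
        simpa [dotProduct, ← sq] using (Real.sqrt_le_iff.1 (ha (t + 1))).2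
      rw [hVs, trace_add, trace_vecMulVec]
      push_cast
      linarith
  have hsum : ∑ t ∈ Finset.Icc 1 T, a t ⬝ᵥ ((V t)⁻¹ *ᵥ a t) ≤
      Real.log (V T).det - Real.log (V 0).det := by
    induction T with
    | zero => simp
    | succ T ih =>
      rw [Finset.sum_Icc_succ_top (by omega)]
      linarith [dotProduct_inv_mulVec_le_log_det_sub (hpos (T + 1)) (hpos T) (hVs T)]
  have hdet0 : Real.log (V 0).det = d * Real.log lam := by simp [hV0]
  have hfac : 0 < 1 + T / (lam * d) := by positivity
  have hdetT : Real.log (V T).det ≤ d * Real.log (lam * (1 + T / (lam * d))) := by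
    have := (hpos T).log_det_le_card_mul_log (c := lam * (1 + T / (lam * d))) (by positivity) (by
      refine (htrace T).trans_eq ?_
      rw [Fintype.card_fin]
      field_simp)
    simpa only [Fintype.card_fin] using this
  rw [Real.log_mul hlam.ne' hfac.ne'] at hdetT
  linarith
end

section
/- Let d ≥ 1, λ > 0, T ≥ 0, and let a_1, ..., a_T ∈ ℝ^d satisfy ‖a_t‖₂ ≤ 1 for every t. Define V_0 = λ I_d and V_t = V_{t-1} + a_t a_tᵀ for t = 1, ..., T. Then Σ_{t=1}^T a_tᵀ (V_{t-1})⁻¹ a_t ≤ d * log(1 + T/(λ d)) + d/λ. -/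
open Matrix

namespace Matrix

variable {n : Type*} [Fintype n]

lemma dotProduct_sq_le (u v : n → ℝ) : (u ⬝ᵥ v) ^ 2 ≤ (u ⬝ᵥ u) * (v ⬝ᵥ v) := by
  simpa [dotProduct, sq] using Finset.sum_mul_sq_le_sq_mul_sq Finset.univ u v

lemma posSemidef_vecMulVec_self (u : n → ℝ) : (vecMulVec u u).PosSemidef := by
  simpa using posSemidef_vecMulVec_self_star u

variable [DecidableEq n]

lemma PosDef.log_det_add_vecMulVec_self {A : Matrix n n ℝ} (hA : A.PosDef) (u : n → ℝ) :
    Real.log (A + vecMulVec u u).det = Real.log A.det + Real.log (1 + u ⬝ᵥ (A⁻¹ *ᵥ u)) := by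
  have hq : 0 ≤ u ⬝ᵥ (A⁻¹ *ᵥ u) := by
    simpa using hA.inv.posSemidef.dotProduct_mulVec_nonneg u
  have hdet : (A + vecMulVec u u).det = A.det * (1 + u ⬝ᵥ (A⁻¹ *ᵥ u)) := by
    have hmul : A + vecMulVec u u = A * (1 + vecMulVec (A⁻¹ *ᵥ u) u) := by
      rw [mul_add, mul_one, mul_vecMulVec, mulVec_mulVec,
        mul_nonsing_inv A hA.det_pos.ne'.isUnit, one_mulVec]
    rw [hmul, det_mul, vecMulVec_eq Unit, det_one_add_replicateCol_mul_replicateRow]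
  rw [hdet, Real.log_mul hA.det_pos.ne' (by positivity)]

lemma PosDef.trace_inv_sub_trace_inv_add_vecMulVec_self {A : Matrix n n ℝ} (hA : A.PosDef)
    (u : n → ℝ) :
    trace A⁻¹ - trace (A + vecMulVec u u)⁻¹ =
      ((A⁻¹ *ᵥ u) ⬝ᵥ (A⁻¹ *ᵥ u)) / (1 + u ⬝ᵥ (A⁻¹ *ᵥ u)) := by
  have hB : (A + vecMulVec u u).PosDef := hA.add_posSemidef (posSemidef_vecMulVec_self u)
  have hq : 0 ≤ u ⬝ᵥ (A⁻¹ *ᵥ u) := by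
    simpa using hA.inv.posSemidef.dotProduct_mulVec_nonneg u
  have hsymm : u ᵥ* A⁻¹ = A⁻¹ *ᵥ u := by
    have h : (A⁻¹)ᵀ = A⁻¹ := by simpa using hA.inv.isHermitian.eq
    rw [← mulVec_transpose, h]
  have hBu : (1 + u ⬝ᵥ (A⁻¹ *ᵥ u)) • ((A + vecMulVec u u)⁻¹ *ᵥ u) = A⁻¹ *ᵥ u := by
    have h : (A + vecMulVec u u) *ᵥ (A⁻¹ *ᵥ u) = (1 + u ⬝ᵥ (A⁻¹ *ᵥ u)) • u := by
      rw [add_mulVec, mulVec_mulVec, mul_nonsing_inv A hA.det_pos.ne'.isUnit, one_mulVec,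
        vecMulVec_mulVec, add_smul, one_smul, op_smul_eq_smul]
    rw [← mulVec_smul, ← h, mulVec_mulVec, nonsing_inv_mul _ hB.det_pos.ne'.isUnit, one_mulVec]
  have hinv := inv_sub_inv (A := A + vecMulVec u u) (B := A) (by simp [hA.isUnit, hB.isUnit])
  rw [sub_add_cancel_left, mul_neg, neg_mul, mul_vecMulVec, vecMulVec_mul, hsymm] at hinv
  rw [← neg_sub, ← trace_sub, hinv, trace_neg, neg_neg, trace_vecMulVec,
    eq_div_iff (by positivity), mul_comm, ← smul_eq_mul, ← smul_dotProduct, hBu]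

/-- The potential `log det A - trace A⁻¹` grows by at least `uᵀ A⁻¹ u` under the rank-one
update `A + u uᵀ`, for `u` in the unit ball. -/
lemma PosDef.dotProduct_inv_mulVec_le {A : Matrix n n ℝ} (hA : A.PosDef) {u : n → ℝ}
    (hu : u ⬝ᵥ u ≤ 1) :
    u ⬝ᵥ (A⁻¹ *ᵥ u) ≤ (Real.log (A + vecMulVec u u).det - trace (A + vecMulVec u u)⁻¹) -
      (Real.log A.det - trace A⁻¹) := by
  have htr := hA.trace_inv_sub_trace_inv_add_vecMulVec_self u
  have hdet := hA.log_det_add_vecMulVec_self u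
  have hcs := dotProduct_sq_le u (A⁻¹ *ᵥ u)
  have hq : 0 ≤ u ⬝ᵥ (A⁻¹ *ᵥ u) := by
    simpa using hA.inv.posSemidef.dotProduct_mulVec_nonneg u
  have hr : 0 ≤ (A⁻¹ *ᵥ u) ⬝ᵥ (A⁻¹ *ᵥ u) := by
    simpa using dotProduct_star_self_nonneg (A⁻¹ *ᵥ u)
  generalize u ⬝ᵥ (A⁻¹ *ᵥ u) = q at *
  generalize (A⁻¹ *ᵥ u) ⬝ᵥ (A⁻¹ *ᵥ u) = r at *
  have hlog := Real.one_sub_inv_le_log_of_pos (show 0 < 1 + q by positivity)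
  have hqr : q ^ 2 / (1 + q) ≤ r / (1 + q) := by
    gcongr
    nlinarith
  have hsplit : q = q ^ 2 / (1 + q) + (1 - (1 + q)⁻¹) := by
    field_simp
    ring
  linarith

lemma PosDef.log_det_le {A : Matrix n n ℝ} (hA : A.PosDef) {c : ℝ} (hc : 0 < c) :
    Real.log A.det ≤ Fintype.card n * Real.log c + A.trace / c - Fintype.card n := by
  have hpos := hA.eigenvalues_pos
  have hdet : A.det = ∏ i, hA.isHermitian.eigenvalues i := by
    simpa using hA.isHermitian.det_eq_prod_eigenvalues
  have htr : A.trace = ∑ i, hA.isHermitian.eigenvalues i := by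
    simpa using hA.isHermitian.trace_eq_sum_eigenvalues
  rw [hdet, htr, Real.log_prod fun i _ => (hpos i).ne']
  calc ∑ i, Real.log (hA.isHermitian.eigenvalues i)
      ≤ ∑ i, (Real.log c + hA.isHermitian.eigenvalues i / c - 1) := by
        refine Finset.sum_le_sum fun i _ => ?_
        have h := Real.log_le_sub_one_of_pos (div_pos (hpos i) hc)
        rw [Real.log_div (hpos i).ne' hc.ne'] at h
        linarith
    _ = _ := by simp [Finset.sum_add_distrib, Finset.sum_sub_distrib, Finset.sum_div]

end Matrix

theorem stmt_12 (d : ℕ) (hd : 1 ≤ d) (lam : ℝ) (hlam : 0 < lam) (T : ℕ)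
    (a : ℕ → (Fin d → ℝ)) (ha : ∀ t, Real.sqrt (∑ i, a t i ^ 2) ≤ 1)
    (V : ℕ → Matrix (Fin d) (Fin d) ℝ)
    (hV0 : V 0 = lam • (1 : Matrix (Fin d) (Fin d) ℝ))
    (hVs : ∀ t, V (t + 1) = V t + Matrix.vecMulVec (a (t + 1)) (a (t + 1))) :
    ∑ t ∈ Finset.Icc 1 T, a t ⬝ᵥ ((V (t - 1))⁻¹ *ᵥ a t) ≤
      d * Real.log (1 + T / (lam * d)) + d / lam := by
  have hd0 : (0 : ℝ) < d := by exact_mod_cast hd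
  have ha' (t : ℕ) : a t ⬝ᵥ a t ≤ 1 := by
    simpa [dotProduct, sq] using ha t
  have hpos (t : ℕ) : (V t).PosDef := by
    induction t with
    | zero => exact hV0 ▸ PosDef.one.smul hlam
    | succ t ih => exact hVs t ▸ ih.add_posSemidef (posSemidef_vecMulVec_self _)
  have htr (t : ℕ) : (V t).trace ≤ d * lam + t := by
    induction t with
    | zero => simp [hV0, mul_comm]
    | succ t ih =>
      rw [hVs, trace_add, trace_vecMulVec]
      push_cast
      linarith [ha' (t + 1)]
  have hsum : ∑ t ∈ Finset.Icc 1 T, a t ⬝ᵥ ((V (t - 1))⁻¹ *ᵥ a t) ≤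
      (Real.log (V T).det - (V T)⁻¹.trace) - (Real.log (V 0).det - (V 0)⁻¹.trace) := by
    induction T with
    | zero => simp
    | succ T ih =>
      rw [Finset.sum_Icc_succ_top (by lia), Nat.add_sub_cancel]
      have h := (hpos T).dotProduct_inv_mulVec_le (ha' (T + 1))
      rw [← hVs] at h
      linarith
  have hdet0 : Real.log (V 0).det = d * Real.log lam := by simp [hV0]
  have htr0 : (V 0)⁻¹.trace = d / lam := by
    have h : (V 0)⁻¹ = lam⁻¹ • (1 : Matrix (Fin d) (Fin d) ℝ) :=
      inv_eq_right_inv (by simp [hV0, smul_smul, hlam.ne'])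
    simp [h, div_eq_inv_mul]
  have htrT : 0 ≤ (V T)⁻¹.trace := (hpos T).inv.posSemidef.trace_nonneg
  have hc : 0 < lam + T / d := by positivity
  have hlogT := (hpos T).log_det_le hc
  have hdiv : (V T).trace / (lam + T / d) ≤ d := by
    rw [div_le_iff₀ hc, mul_add, mul_div_cancel₀ _ hd0.ne']
    exact htr T
  have hlog : Real.log (1 + T / (lam * d)) = Real.log (lam + T / d) - Real.log lam := by
    rw [← Real.log_div hc.ne' hlam.ne']
    congr 1
    field_simp
  rw [Fintype.card_fin] at hlogT
  rw [hlog, mul_sub]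
  linarith
end

section
/- Let (Ω, F, P) be a probability space with a filtration (F_t)_{t≥0}. For t ≥ 1, let I_t be an F_{t-1}-measurable random variable taking values in {0, 1} (a predictable indicator), and let ε_t be an F_t-measurable real random variable satisfying, almost surely, E[exp(λ ε_t) | F_{t-1}] ≤ exp(λ²/2) for every real λ (conditional 1-subgaussianity; in particular E[ε_t | F_{t-1}] = 0). Define M_t = Σ_{s=1}^t I_s ε_s and N_t = Σ_{s=1}^t I_s. Then for every δ ∈ (0, 1), with probability at least 1 - δ, simultaneously for all t ≥ 1 with N_t > 0: |M_t| / N_t ≤ sqrt( (4 * log(1/δ) + 2 * log(1 + N_t)) / N_t ). -/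
open MeasureTheory

/-- If the set integrals of `g` over sets of a sub-σ-algebra are at most `c` times their measure,
then `g` can be replaced by `c` when integrated against a function measurable for that σ-algebra. -/
theorem lintegral_mul_le_of_forall_setLIntegral_le {Ω : Type*} {m m0 : MeasurableSpace Ω}
    {μ : Measure Ω} (hm : m ≤ m0) {f g : Ω → ENNReal} {c : ENNReal}
    (hf : Measurable[m] f) (hg : Measurable g)
    (h : ∀ s, MeasurableSet[m] s → ∫⁻ ω in s, g ω ∂μ ≤ c * μ s) :
    ∫⁻ ω, g ω * f ω ∂μ ≤ c * ∫⁻ ω, f ω ∂μ := by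
  have hle : (μ.withDensity g).trim hm ≤ (c • μ).trim hm := by
    refine Measure.le_iff.2 fun s hs => ?_
    rw [trim_measurableSet_eq hm hs, trim_measurableSet_eq hm hs, withDensity_apply _ (hm s hs)]
    simpa using h s hs
  have := lintegral_mono' hle (le_refl f)
  rw [lintegral_trim hm hf, lintegral_trim hm hf, lintegral_smul_measure,
    lintegral_withDensity_eq_lintegral_mul _ hg (hf.mono hm le_rfl)] at this
  simpa using this

/-- Set integrals of a nonnegative function whose conditional expectation is bounded by `c`. -/
theorem setLIntegral_ofReal_le_of_condExp_le {Ω : Type*} {m m0 : MeasurableSpace Ω}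
    {μ : Measure Ω} [IsFiniteMeasure μ] (hm : m ≤ m0) {g : Ω → ℝ} {c : ℝ}
    (hg : Integrable g μ) (hg0 : 0 ≤ g) (hc : ∀ᵐ ω ∂μ, (μ[g|m]) ω ≤ c)
    {s : Set Ω} (hs : MeasurableSet[m] s) :
    ∫⁻ ω in s, ENNReal.ofReal (g ω) ∂μ ≤ ENNReal.ofReal c * μ s := by
  have hle : ∫ ω in s, g ω ∂μ ≤ c * μ.real s := by
    rw [← setIntegral_condExp hm hg hs]
    calc ∫ ω in s, (μ[g|m]) ω ∂μ ≤ ∫ _ in s, c ∂μ :=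
          integral_mono_ae integrable_condExp.integrableOn (integrable_const c)
            (ae_restrict_of_ae hc)
      _ = c * μ.real s := by simp [mul_comm]
  rw [← ofReal_integral_eq_lintegral_ofReal hg.integrableOn (Filter.Eventually.of_forall hg0)]
  refine (ENNReal.ofReal_le_ofReal hle).trans ?_
  rw [ENNReal.ofReal_mul' measureReal_nonneg, ofReal_measureReal]

/-- Ville's inequality for a nonnegative supermartingale started at mass at most one. -/
theorem mul_measure_exists_le_of_setLIntegral_succ_le {Ω : Type*} {m0 : MeasurableSpace Ω}
    {μ : Measure Ω} (F : Filtration ℕ m0) {L : ℕ → Ω → ENNReal}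
    (hL : ∀ t, Measurable[F t] (L t)) (h0 : ∫⁻ ω, L 0 ω ∂μ ≤ 1)
    (hstep : ∀ t s, MeasurableSet[F t] s → ∫⁻ ω in s, L (t + 1) ω ∂μ ≤ ∫⁻ ω in s, L t ω ∂μ)
    (c : ENNReal) : c * μ {ω | ∃ t, c ≤ L t ω} ≤ 1 := by
  set A : ℕ → Set Ω := fun t => {ω | ∀ s ≤ t, L s ω < c} with hA
  have hAm : ∀ t, MeasurableSet[F t] (A t) := by
    intro t
    have : A t = ⋂ s, ⋂ (_ : s ≤ t), {ω | L s ω < c} := by ext; simp [hA]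
    rw [this]
    refine MeasurableSet.iInter fun s => MeasurableSet.iInter fun hs => ?_
    exact F.mono hs _ (measurableSet_lt (hL s) measurable_const)
  have hAm' : ∀ t, MeasurableSet (A t) := fun t => F.le t _ (hAm t)
  have hanti : ∀ t, A (t + 1) ⊆ A t := fun t ω h s hs => h s (hs.trans t.le_succ)
  have cheb : ∀ (t : ℕ) (s : Set Ω), MeasurableSet s → (∀ ω ∈ s, c ≤ L t ω) →
      c * μ s ≤ ∫⁻ ω in s, L t ω ∂μ := by
    intro t s hs h
    rw [← setLIntegral_const]
    exact setLIntegral_mono' hs h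
  have key : ∀ t, c * μ (A t)ᶜ + ∫⁻ ω in A t, L t ω ∂μ ≤ 1 := by
    intro t
    induction t with
    | zero =>
      refine le_trans ?_ h0
      rw [← lintegral_add_compl (μ := μ) _ (hAm' 0), add_comm]
      exact add_le_add_right (cheb 0 _ (hAm' 0).compl fun ω hω => by simpa [hA] using hω) _
    | succ t ih =>
      refine le_trans ?_ ih
      have hsplit : (A (t + 1))ᶜ = (A t)ᶜ ∪ (A t \ A (t + 1)) := by
        ext ω
        have := @hanti t ω
        simp only [Set.mem_compl_iff, Set.mem_union, Set.mem_sdiff]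
        tauto
      have hd : c * μ (A t \ A (t + 1)) ≤ ∫⁻ ω in A t \ A (t + 1), L (t + 1) ω ∂μ := by
        refine cheb _ _ ((hAm' t).diff (hAm' _)) fun ω hω => ?_
        by_contra! hlt
        refine hω.2 fun s hs => ?_
        rcases Nat.le_succ_iff.1 hs with h | h
        · exact hω.1 s h
        · exact h ▸ hlt
      calc c * μ (A (t + 1))ᶜ + ∫⁻ ω in A (t + 1), L (t + 1) ω ∂μ
          ≤ (c * μ (A t)ᶜ + c * μ (A t \ A (t + 1))) + ∫⁻ ω in A (t + 1), L (t + 1) ω ∂μ := by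
            rw [hsplit, ← mul_add]
            gcongr
            exact measure_union_le _ _
        _ ≤ c * μ (A t)ᶜ + (∫⁻ ω in A t ∩ A (t + 1), L (t + 1) ω ∂μ
              + ∫⁻ ω in A t \ A (t + 1), L (t + 1) ω ∂μ) := by
            rw [Set.inter_eq_right.2 (hanti t), add_assoc,
              add_comm (c * μ (A t \ A (t + 1)))]
            gcongr
        _ ≤ c * μ (A t)ᶜ + ∫⁻ ω in A t, L t ω ∂μ := by
            rw [lintegral_inter_add_sdiff _ _ (hAm' (t + 1))]
            exact add_le_add_right (hstep t _ (hAm t)) _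
  have hunion : {ω | ∃ t, c ≤ L t ω} = ⋃ t, (A t)ᶜ := by
    ext ω
    simp only [hA, Set.mem_ofPred_eq, Set.mem_iUnion, Set.mem_compl_iff, not_forall, not_lt]
    exact ⟨fun ⟨t, h⟩ => ⟨t, t, le_rfl, h⟩, fun ⟨_, s, _, h⟩ => ⟨s, h⟩⟩
  rw [hunion, (monotone_nat_of_le_succ fun t => Set.compl_subset_compl.2 (hanti t)).measure_iUnion,
    ENNReal.mul_iSup]
  exact iSup_le fun t => le_self_add.trans (key t)

/-- Gaussian mixture of the exponentials `exp (x * M - x ^ 2 * N / 2)`. -/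
theorem lintegral_gaussianReal_exp_mul_sub (M : ℝ) {N : ℝ} (hN : 0 ≤ N) :
    ∫⁻ x, ENNReal.ofReal (Real.exp (x * M - x ^ 2 * N / 2)) ∂(ProbabilityTheory.gaussianReal 0 1) =
      ENNReal.ofReal (Real.exp (M ^ 2 / (2 * (1 + N))) / Real.sqrt (1 + N)) := by
  have hN1 : 0 < 1 + N := by linarith
  obtain ⟨v, hv⟩ : ∃ v : NNReal, (v : ℝ) = (1 + N)⁻¹ :=
    ⟨(1 + N)⁻¹.toNNReal, Real.coe_toNNReal _ (by positivity)⟩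
  have hv0 : v ≠ 0 := by
    rintro rfl
    exact (inv_pos.2 hN1).ne hv
  rw [ProbabilityTheory.gaussianReal_of_var_ne_zero _ one_ne_zero,
    lintegral_withDensity_eq_lintegral_mul _ (ProbabilityTheory.measurable_gaussianPDF _ _)
      (by fun_prop)]
  have hpt : ∀ x : ℝ, (ProbabilityTheory.gaussianPDF 0 1 * fun x =>
      ENNReal.ofReal (Real.exp (x * M - x ^ 2 * N / 2))) x =
      ENNReal.ofReal (Real.exp (M ^ 2 / (2 * (1 + N))) / Real.sqrt (1 + N)) *
        ProbabilityTheory.gaussianPDF (M / (1 + N)) v x := by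
    intro x
    simp only [Pi.mul_apply, ProbabilityTheory.gaussianPDF]
    rw [← ENNReal.ofReal_mul (ProbabilityTheory.gaussianPDFReal_nonneg _ _ _),
      ← ENNReal.ofReal_mul (by positivity)]
    congr 1
    simp only [ProbabilityTheory.gaussianPDFReal, hv, NNReal.coe_one, mul_one, sub_zero]
    rw [Real.sqrt_mul (by positivity) (1 + N)⁻¹, Real.sqrt_inv]
    have hs : Real.sqrt (1 + N) ≠ 0 := (Real.sqrt_pos.2 hN1).ne'
    have hexp : Real.exp (-x ^ 2 / 2) * Real.exp (x * M - x ^ 2 * N / 2) =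
        Real.exp (M ^ 2 / (2 * (1 + N))) *
          Real.exp (-(x - M / (1 + N)) ^ 2 / (2 * (1 + N)⁻¹)) := by
      rw [← Real.exp_add, ← Real.exp_add]
      congr 1
      field_simp
      ring
    rw [mul_assoc, hexp]
    field_simp
  simp_rw [hpt]
  rw [lintegral_const_mul _ (ProbabilityTheory.measurable_gaussianPDF _ _),
    ProbabilityTheory.lintegral_gaussianPDF_eq_one _ hv0, mul_one]

/-- One step of the exponential process of a sum with predictable indicators and conditionally
subgaussian noise decreases in mean. -/
theorem setLIntegral_exp_add_indicator_mul_le {Ω : Type*} {m m0 : MeasurableSpace Ω}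
    {μ : Measure Ω} [IsFiniteMeasure μ] (hm : m ≤ m0) {M N I ε : Ω → ℝ} {x : ℝ}
    (hM : Measurable[m] M) (hN : Measurable[m] N) (hI : Measurable[m] I)
    (hI01 : ∀ ω, I ω = 0 ∨ I ω = 1) (hε : Measurable ε)
    (hint : Integrable (fun ω => Real.exp (x * ε ω)) μ)
    (hsub : ∀ᵐ ω ∂μ, (μ[fun ω => Real.exp (x * ε ω)|m]) ω ≤ Real.exp (x ^ 2 / 2))
    {s : Set Ω} (hs : MeasurableSet[m] s) :
    ∫⁻ ω in s, ENNReal.ofReal (Real.exp (x * (M ω + I ω * ε ω) - x ^ 2 * (N ω + I ω) / 2)) ∂μ ≤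
      ∫⁻ ω in s, ENNReal.ofReal (Real.exp (x * M ω - x ^ 2 * N ω / 2)) ∂μ := by
  have hB : MeasurableSet[m] {ω | I ω = 1} := hI (measurableSet_singleton 1)
  have hsB := hs.inter hB
  rw [← lintegral_inter_add_sdiff _ s (hm _ hB), ← lintegral_inter_add_sdiff _ s (hm _ hB)]
  gcongr ?_ + ?_
  · set f : Ω → ENNReal := (s ∩ {ω | I ω = 1}).indicator fun ω =>
      ENNReal.ofReal (Real.exp (x * M ω - x ^ 2 * N ω / 2)) with hf
    have hfm : Measurable[m] f := by
      refine Measurable.indicator ?_ hsB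
      exact ((((hM.const_mul x).sub ((hN.const_mul (x ^ 2)).div_const 2))).exp).ennreal_ofReal
    have hmain := lintegral_mul_le_of_forall_setLIntegral_le (μ := μ) hm hfm
      (g := fun ω => ENNReal.ofReal (Real.exp (x * ε ω))) (by fun_prop) fun u hu =>
        setLIntegral_ofReal_le_of_condExp_le hm hint (fun ω => (Real.exp_pos _).le) hsub hu
    have hL : ∫⁻ ω in s ∩ {ω | I ω = 1}, ENNReal.ofReal
        (Real.exp (x * (M ω + I ω * ε ω) - x ^ 2 * (N ω + I ω) / 2)) ∂μ =
        ENNReal.ofReal (Real.exp (-(x ^ 2 / 2))) *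
          ∫⁻ ω, ENNReal.ofReal (Real.exp (x * ε ω)) * f ω ∂μ := by
      rw [← lintegral_const_mul' _ _ ENNReal.ofReal_ne_top, ← lintegral_indicator (hm _ hsB)]
      refine lintegral_congr fun ω => ?_
      by_cases hω : ω ∈ s ∩ {ω | I ω = 1}
      · have hω1 : I ω = 1 := hω.2
        simp only [hf, Set.indicator_of_mem hω, hω1]
        rw [← ENNReal.ofReal_mul (Real.exp_pos _).le, ← ENNReal.ofReal_mul (Real.exp_pos _).le,
          ← Real.exp_add, ← Real.exp_add]
        ring_nf
      · simp [hf, Set.indicator_of_notMem hω]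
    rw [hL, ← lintegral_indicator (hm _ hsB)]
    calc _ ≤ ENNReal.ofReal (Real.exp (-(x ^ 2 / 2))) *
          (ENNReal.ofReal (Real.exp (x ^ 2 / 2)) * ∫⁻ ω, f ω ∂μ) := by gcongr
      _ = ∫⁻ ω, f ω ∂μ := by
        rw [← mul_assoc, ← ENNReal.ofReal_mul (Real.exp_pos _).le, ← Real.exp_add]
        simp
  · refine (setLIntegral_congr_fun (hm _ (hs.diff hB)) fun ω hω => ?_).le
    have hω0 : I ω = 0 := (hI01 ω).resolve_right hω.2
    simp [hω0]

/-- A self-normalized bound read off from the Gaussian-mixture bound. -/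
theorem abs_div_le_sqrt_of_exp_div_sqrt_lt {M N δ : ℝ} (hN : 1 ≤ N) (hδ : 0 < δ)
    (h : Real.exp (M ^ 2 / (2 * (1 + N))) / Real.sqrt (1 + N) < 1 / δ) (hδ1 : δ < 1) :
    |M| / N ≤ Real.sqrt ((4 * Real.log (1 / δ) + 2 * Real.log (1 + N)) / N) := by
  have hN1 : 0 < 1 + N := by linarith
  have hN0 : 0 < N := by linarith
  have hs : 0 < Real.sqrt (1 + N) := Real.sqrt_pos.2 hN1
  have hlog := Real.log_lt_log (by positivity) h
  rw [Real.log_div (Real.exp_pos _).ne' hs.ne', Real.log_exp, Real.log_sqrt hN1.le,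
    sub_lt_iff_lt_add, div_lt_iff₀ (by positivity)] at hlog
  have h1 : 0 < Real.log (1 / δ) := Real.log_pos (by rw [lt_div_iff₀ hδ]; linarith)
  have h2 : 0 < Real.log (1 + N) := Real.log_pos (by linarith)
  refine Real.le_sqrt_of_sq_le ?_
  rw [div_pow, sq_abs, div_le_div_iff₀ (by positivity) hN0]
  have h3 : M ^ 2 ≤ (4 * Real.log (1 / δ) + 2 * Real.log (1 + N)) * N := by nlinarith
  nlinarith [mul_le_mul_of_nonneg_right h3 hN0.le]

theorem stmt_14 {Ω : Type*} {m0 : MeasurableSpace Ω}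
    (μ : Measure Ω) [IsProbabilityMeasure μ] (F : Filtration ℕ m0)
    (I ε : ℕ → Ω → ℝ)
    (hI01 : ∀ (t : ℕ) (ω : Ω), I (t + 1) ω = 0 ∨ I (t + 1) ω = 1)
    (hImeas : ∀ t : ℕ, Measurable[F t] (I (t + 1)))
    (hεmeas : ∀ t : ℕ, Measurable[F (t + 1)] (ε (t + 1)))
    (hint : ∀ (t : ℕ) (l : ℝ), Integrable (fun ω => Real.exp (l * ε (t + 1) ω)) μ)
    (hsub : ∀ (t : ℕ) (l : ℝ), ∀ᵐ ω ∂μ,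
      (μ[fun ω => Real.exp (l * ε (t + 1) ω)|F t]) ω ≤ Real.exp (l ^ 2 / 2))
    (δ : ℝ) (hδ : δ ∈ Set.Ioo (0 : ℝ) 1) :
    ENNReal.ofReal (1 - δ) ≤
      μ {ω | ∀ t : ℕ, 1 ≤ t →
        0 < (∑ s ∈ Finset.range t, I (s + 1) ω) →
        |∑ s ∈ Finset.range t, I (s + 1) ω * ε (s + 1) ω| /
            (∑ s ∈ Finset.range t, I (s + 1) ω) ≤
          Real.sqrt ((4 * Real.log (1 / δ) +
              2 * Real.log (1 + ∑ s ∈ Finset.range t, I (s + 1) ω)) /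
            (∑ s ∈ Finset.range t, I (s + 1) ω))} := by
  obtain ⟨hδ0, hδ1⟩ := hδ
  set M : ℕ → Ω → ℝ := fun t ω => ∑ s ∈ Finset.range t, I (s + 1) ω * ε (s + 1) ω with hM
  set N : ℕ → Ω → ℝ := fun t ω => ∑ s ∈ Finset.range t, I (s + 1) ω with hN
  have hNm : ∀ t, Measurable[F t] (N t) := fun t =>
    Finset.measurable_fun_sum _ fun s hs =>
      (hImeas s).mono (F.mono (Finset.mem_range.1 hs).le) le_rfl
  have hMm : ∀ t, Measurable[F t] (M t) := fun t =>
    Finset.measurable_fun_sum _ fun s hs =>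
      ((hImeas s).mono (F.mono (Finset.mem_range.1 hs).le) le_rfl).mul
        ((hεmeas s).mono (F.mono (Finset.mem_range.1 hs)) le_rfl)
  have hI0 : ∀ t ω, 0 ≤ I (t + 1) ω := fun t ω => by rcases hI01 t ω with h | h <;> simp [h]
  have hN0 : ∀ t ω, 0 ≤ N t ω := fun t ω => Finset.sum_nonneg fun s _ => hI0 s ω
  have hN1 : ∀ t ω, 0 < N t ω → 1 ≤ N t ω := by
    intro t ω hpos
    obtain ⟨s, hs, hne⟩ := Finset.exists_ne_zero_of_sum_ne_zero hpos.ne'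
    rw [← (hI01 s ω).resolve_left hne]
    exact Finset.single_le_sum (f := fun s => I (s + 1) ω) (fun s _ => hI0 s ω) hs
  set L : ℕ → Ω → ENNReal := fun t ω =>
    ENNReal.ofReal (Real.exp (M t ω ^ 2 / (2 * (1 + N t ω))) / Real.sqrt (1 + N t ω)) with hL
  have hLm : ∀ t, Measurable[F t] (L t) := fun t =>
    ((((hMm t).pow_const 2).div (((hNm t).const_add 1).const_mul 2)).exp.div
      ((hNm t).const_add 1).sqrt).ennreal_ofReal
  have hswap : ∀ t s, ∫⁻ ω in s, L t ω ∂μ = ∫⁻ x, ∫⁻ ω in s,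
      ENNReal.ofReal (Real.exp (x * M t ω - x ^ 2 * N t ω / 2)) ∂μ
        ∂(ProbabilityTheory.gaussianReal 0 1) := by
    intro t s
    have hM' := (hMm t).mono (F.le t) le_rfl
    have hN' := (hNm t).mono (F.le t) le_rfl
    rw [lintegral_lintegral_swap]
    · exact lintegral_congr fun ω => (lintegral_gaussianReal_exp_mul_sub _ (hN0 t ω)).symm
    · exact Measurable.aemeasurable (by fun_prop)
  have hville := mul_measure_exists_le_of_setLIntegral_succ_le (μ := μ) F hLm
    (by simp [hL, hM, hN]) (fun t s hs => by
      rw [hswap, hswap]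
      refine lintegral_mono fun x => ?_
      simp only [hM, hN, Finset.sum_range_succ]
      exact setLIntegral_exp_add_indicator_mul_le (F.le t) (hMm t) (hNm t) (hImeas t) (hI01 t)
        ((hεmeas t).mono (F.le _) le_rfl) (hint t x) (hsub t x) hs) (ENNReal.ofReal (1 / δ))
  set B : Set Ω := {ω | ∃ t, ENNReal.ofReal (1 / δ) ≤ L t ω} with hB
  have hBm : MeasurableSet B := by
    have : B = ⋃ t, {ω | ENNReal.ofReal (1 / δ) ≤ L t ω} := by ext; simp [hB]
    rw [this]
    exact MeasurableSet.iUnion fun t =>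
      measurableSet_le measurable_const ((hLm t).mono (F.le t) le_rfl)
  have hBδ : μ B ≤ ENNReal.ofReal δ := by
    calc μ B = ENNReal.ofReal δ * (ENNReal.ofReal (1 / δ) * μ B) := by
          rw [← mul_assoc, ← ENNReal.ofReal_mul hδ0.le, mul_one_div_cancel hδ0.ne']
          simp
      _ ≤ ENNReal.ofReal δ * 1 := by gcongr
      _ = ENNReal.ofReal δ := mul_one _
  calc ENNReal.ofReal (1 - δ) = 1 - ENNReal.ofReal δ := by
        rw [ENNReal.ofReal_sub _ hδ0.le, ENNReal.ofReal_one]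
    _ ≤ 1 - μ B := tsub_le_tsub_left hBδ _
    _ = μ Bᶜ := (prob_compl_eq_one_sub hBm).symm
    _ ≤ _ := by
      refine measure_mono fun ω hω t _ hpos => ?_
      refine abs_div_le_sqrt_of_exp_div_sqrt_lt (hN1 t ω hpos) hδ0 ?_ hδ1
      by_contra! hge
      exact hω ⟨t, ENNReal.ofReal_le_ofReal hge⟩
end
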